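/- arXiv:1708.00509 — 2 statements merged into one kernel-verified Lean document; each statement's English description precedes it below -/
import Mathlib

section
/- Let r ≥ 0 and for x ∈ ℝ let M(x) denote the real symmetric matrix [[2x² − 1, −r x], [−r x, 1]], and let m(x) denote its smallest eigenvalue. Then m is monotone on [1, ∞): if r < 2 then m is monotonically increasing on [1, ∞), and if r > 2 then m is monotonically decreasing on [1, ∞). -/
/-- The radicand written as a completed square in `s = x²`, with `k = (r² - 2) / 2`. -/
lemma radicand_eq (r x : ℝ) :
    (x ^ 2 - 1) ^ 2 + r ^ 2 * x ^ 2
      = (x ^ 2 + (r ^ 2 - 2) / 2) ^ 2 + r ^ 2 * (4 - r ^ 2) / 4 := by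
  ring

/-- For r ≥ 0, the smallest eigenvalue m(x) = x² − √((x² − 1)² + r²x²) of
the real symmetric matrix M(x) = [[2x² − 1, −r x], [−r x, 1]] is monotone on [1, ∞):
increasing if r < 2 and decreasing if r > 2. -/
theorem stmt_8 (r : ℝ) (hr : 0 ≤ r) :
    (r < 2 → MonotoneOn
        (fun x : ℝ => x ^ 2 - Real.sqrt ((x ^ 2 - 1) ^ 2 + r ^ 2 * x ^ 2)) (Set.Ici 1)) ∧
    (2 < r → AntitoneOn
        (fun x : ℝ => x ^ 2 - Real.sqrt ((x ^ 2 - 1) ^ 2 + r ^ 2 * x ^ 2)) (Set.Ici 1)) := by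
  refine ⟨fun h x hx y _ hxy => ?_, fun h x hx y _ hxy => ?_⟩
  all_goals
    have hx1 : (1 : ℝ) ≤ x := hx
    have hst : 0 ≤ y ^ 2 - x ^ 2 := by nlinarith
    have hS : 0 ≤ (x ^ 2 - 1) ^ 2 + r ^ 2 * x ^ 2 := by positivity
    have hsq := Real.sq_sqrt hS
    have hnn := Real.sqrt_nonneg ((x ^ 2 - 1) ^ 2 + r ^ 2 * x ^ 2)
  · have hle : x ^ 2 + (r ^ 2 - 2) / 2 ≤ √((x ^ 2 - 1) ^ 2 + r ^ 2 * x ^ 2) := by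
      apply Real.le_sqrt_of_sq_le
      have : 0 ≤ r ^ 2 * (4 - r ^ 2) := mul_nonneg (sq_nonneg r) (by nlinarith)
      linarith [radicand_eq r x]
    have : √((y ^ 2 - 1) ^ 2 + r ^ 2 * y ^ 2)
        ≤ √((x ^ 2 - 1) ^ 2 + r ^ 2 * x ^ 2) + (y ^ 2 - x ^ 2) := by
      apply Real.sqrt_le_iff.mpr ⟨by linarith, ?_⟩
      linarith [mul_le_mul_of_nonneg_left hle hst]
    dsimp only
    linarith
  · have hle : √((x ^ 2 - 1) ^ 2 + r ^ 2 * x ^ 2) ≤ x ^ 2 + (r ^ 2 - 2) / 2 := by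
      apply Real.sqrt_le_iff.mpr ⟨by nlinarith, ?_⟩
      have : 0 ≤ r ^ 2 * (r ^ 2 - 4) := mul_nonneg (sq_nonneg r) (by nlinarith)
      linarith [radicand_eq r x]
    have : √((x ^ 2 - 1) ^ 2 + r ^ 2 * x ^ 2) + (y ^ 2 - x ^ 2)
        ≤ √((y ^ 2 - 1) ^ 2 + r ^ 2 * y ^ 2) := by
      apply Real.le_sqrt_of_sq_le
      linarith [mul_le_mul_of_nonneg_left hle hst]
    dsimp only
    linarith
end

section
/- Let r ≥ 0. Then the infimum over x ∈ [1, ∞) of the smallest eigenvalue of the real symmetric matrix M(x) = [[2x² − 1, −r x], [−r x, 1]] equals min{1 − r, 1 − r²/2}. -/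
/-- For r ≥ 0, the infimum over x ∈ [1, ∞) of the smallest eigenvalue
m(x) = x² − √((x² − 1)² + r²x²) of M(x) = [[2x² − 1, −r x], [−r x, 1]] equals
min{1 − r, 1 − r²/2}. -/
theorem stmt_9 (r : ℝ) (hr : 0 ≤ r) :
    sInf ((fun x : ℝ => x ^ 2 - Real.sqrt ((x ^ 2 - 1) ^ 2 + r ^ 2 * x ^ 2)) '' Set.Ici 1)
      = min (1 - r) (1 - r ^ 2 / 2) := by
  rcases le_total r 2 with h2 | h2
  · rw [min_eq_left (by nlinarith)]
    refine IsLeast.csInf_eq ⟨⟨1, Set.mem_Ici.2 le_rfl, ?_⟩, ?_⟩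
    · simp [Real.sqrt_sq hr]
    · rintro _ ⟨x, hx, rfl⟩
      have hx1 : 1 ≤ x ^ 2 := one_le_pow₀ hx
      have : Real.sqrt ((x ^ 2 - 1) ^ 2 + r ^ 2 * x ^ 2) ≤ x ^ 2 - 1 + r := by
        refine Real.sqrt_le_iff.2 ⟨by linarith, ?_⟩
        nlinarith [mul_nonneg (mul_nonneg hr (sub_nonneg.2 h2)) (sub_nonneg.2 hx1)]
      linarith
  · rw [min_eq_right (by nlinarith)]
    refine csInf_eq_of_forall_ge_of_forall_gt_exists_lt (Set.nonempty_Ici.image _) ?_ ?_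
    · rintro _ ⟨x, hx, rfl⟩
      have hx1 : 1 ≤ x ^ 2 := one_le_pow₀ hx
      have : Real.sqrt ((x ^ 2 - 1) ^ 2 + r ^ 2 * x ^ 2) ≤ x ^ 2 - 1 + r ^ 2 / 2 := by
        refine Real.sqrt_le_iff.2 ⟨by nlinarith, ?_⟩
        have h4 : 4 ≤ r ^ 2 := by nlinarith
        nlinarith [mul_nonneg (sq_nonneg r) (sub_nonneg.2 h4)]
      linarith
    · intro w hw
      have hpos : 0 < 2 * w + r ^ 2 - 2 := by linarith
      have hq : 0 ≤ w ^ 2 / (2 * w + r ^ 2 - 2) := by positivity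
      refine ⟨_, ⟨Real.sqrt (1 + w ^ 2 / (2 * w + r ^ 2 - 2)),
        Real.one_le_sqrt.2 (by linarith), rfl⟩, ?_⟩
      have hmul : (2 * w + r ^ 2 - 2) * (w ^ 2 / (2 * w + r ^ 2 - 2)) = w ^ 2 :=
        mul_div_cancel₀ _ hpos.ne'
      beta_reduce
      rw [Real.sq_sqrt (by linarith), sub_lt_comm]
      refine Real.lt_sqrt_of_sq_lt ?_
      generalize w ^ 2 / (2 * w + r ^ 2 - 2) = q at *
      nlinarith
end
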